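/- arXiv:2301.04817 — 5 statements merged into one kernel-verified Lean document; each statement's English description precedes it below -/
import Mathlib

section
/- Consider one no-equivocation round with well-behaved/impersonated structure. Let m1 and m2 be two distinct messages such that no well-behaved processor broadcasts m2, i.e. v q ≠ m2 for every q ∈ W. If some processor p receives m1 from a strict majority, then for every processor p' one has |{q | rcv p' q = some (some m2)}| < |{q | rcv p' q = some (some m1)}|, i.e. p' receives m2 from strictly fewer processors than it receives m1 from. -/
/-- In one no-equivocation round with well-behaved/impersonated structure,
if no well-behaved processor broadcasts `m2 ≠ m1` and some processor `p` receives `m1`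
from a strict majority, then every processor `p'` receives `m2` from strictly fewer
processors than it receives `m1` from. -/
theorem stmt_5 {P M : Type*} (rcv : P → P → Option (Option M))
    (hfin : ∀ p : P, {q | rcv p q ≠ none}.Finite)
    (noeq : ∀ p p' q : P, ∀ m m' : M,
      rcv p q = some (some m) → rcv p' q = some (some m') → m = m')
    (fnote : ∀ p p' q : P, ∀ m : M, rcv p q = some (some m) → rcv p' q ≠ none)
    (W F : Set P) (hWfin : W.Finite) (hFfin : F.Finite)
    (hdisj : Disjoint W F) (hWF : F.ncard < W.ncard)
    (v : P → M)
    (hbcast : ∀ q ∈ W, ∀ p : P, rcv p q = some (some (v q)))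
    (hheard : ∀ p q : P, rcv p q ≠ none → q ∈ W ∪ F)
    (m1 m2 : M) (hne : m1 ≠ m2)
    (hnb : ∀ q ∈ W, v q ≠ m2)
    (p : P)
    (hmaj : 2 * {q | rcv p q = some (some m1)}.ncard > {q | rcv p q ≠ none}.ncard)
    (p' : P) :
    {q | rcv p' q = some (some m2)}.ncard < {q | rcv p' q = some (some m1)}.ncard := by
  classical
  set H := {q | rcv p q ≠ none} with hH
  set A := {q | rcv p q = some (some m1)} with hA
  set B := {q | rcv p' q = some (some m2)} with hB
  set C := {q | rcv p' q = some (some m1)} with hC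
  have hHf : H.Finite := hfin p
  have hAf : (A ∩ F).Finite := hFfin.subset Set.inter_subset_right
  have hBF : B ⊆ F := by
    intro q hq
    have hq' : rcv p' q = some (some m2) := hq
    rcases hheard p' q (by simp [hq']) with h | h
    · exact absurd (noeq p' p' q _ _ (hbcast q h p') hq') (hnb q h)
    · exact h
  have hBf : B.Finite := hFfin.subset hBF
  have hCf : C.Finite := (hfin p').subset (by
    intro q hq
    have hq' : rcv p' q = some (some m1) := hq
    simp [hq'])
  have hdAB : Disjoint (A ∩ F) B := by
    rw [Set.disjoint_left]
    intro q hq hb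
    exact hne (noeq p p' q _ _ hq.1 hb)
  have hsub : (A ∩ F) ∪ B ⊆ F := Set.union_subset Set.inter_subset_right hBF
  have h1 : (A ∩ F).ncard + B.ncard ≤ F.ncard := by
    rw [← Set.ncard_union_eq hdAB hAf hBf]
    exact Set.ncard_le_ncard hsub hFfin
  have h2 : W.ncard + ((A ∩ F).ncard + B.ncard) ≤ H.ncard := by
    rw [← Set.ncard_union_eq hdAB hAf hBf,
      ← Set.ncard_union_eq (hdisj.mono_right hsub) hWfin (hAf.union hBf)]
    refine Set.ncard_le_ncard ?_ hHf
    rintro q (h | h | h)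
    · exact fnote p p q _ (hbcast q h p)
    · exact fnote p p q _ h.1
    · exact fnote p' p q _ h
  have h3 : A.ncard ≤ C.ncard + (A ∩ F).ncard := by
    refine le_trans (Set.ncard_le_ncard ?_ (hCf.union hAf)) (Set.ncard_union_le _ _)
    intro q hq
    have hq' : rcv p q = some (some m1) := hq
    rcases hheard p q (by simp [hq']) with h | h
    · left
      have := noeq p p q _ _ (hbcast q h p) hq'
      show rcv p' q = some (some m1)
      rw [← this]
      exact hbcast q h p'
    · exact Or.inr ⟨hq, h⟩
  omega
end

section
/- Consider one no-equivocation round with well-behaved/impersonated structure. If a processor p receives a message m from a strict majority, then at least one well-behaved processor sent m in that round, i.e. there exists q ∈ W with v q = m. -/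
/-- In one no-equivocation round with well-behaved/impersonated structure,
if `p` receives `m` from a strict majority, then some well-behaved processor sent `m`. -/
theorem stmt_6 {P M : Type*} (rcv : P → P → Option (Option M))
    (hfin : ∀ p : P, {q | rcv p q ≠ none}.Finite)
    (noeq : ∀ p p' q : P, ∀ m m' : M,
      rcv p q = some (some m) → rcv p' q = some (some m') → m = m')
    (fnote : ∀ p p' q : P, ∀ m : M, rcv p q = some (some m) → rcv p' q ≠ none)
    (W F : Set P) (hWfin : W.Finite) (hFfin : F.Finite)
    (hdisj : Disjoint W F) (hWF : F.ncard < W.ncard)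
    (v : P → M)
    (hbcast : ∀ q ∈ W, ∀ p : P, rcv p q = some (some (v q)))
    (hheard : ∀ p q : P, rcv p q ≠ none → q ∈ W ∪ F)
    (p : P) (m : M)
    (hmaj : 2 * {q | rcv p q = some (some m)}.ncard > {q | rcv p q ≠ none}.ncard) :
    ∃ q ∈ W, v q = m := by
  by_contra hcon
  have hSW : ∀ q, rcv p q = some (some m) → q ∉ W := by
    intro q hq hW
    have h := hbcast q hW p
    exact hcon ⟨q, hW, noeq p p q _ _ h hq⟩
  have hSF : {q | rcv p q = some (some m)} ⊆ F := by
    intro q hq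
    have hq' : rcv p q = some (some m) := hq
    rcases hheard p q (by rw [hq']; simp) with h | h
    · exact absurd h (hSW q hq')
    · exact h
  have hS := Set.ncard_le_ncard hSF hFfin
  have hd : Disjoint {q | rcv p q = some (some m)} W :=
    Set.disjoint_left.mpr hSW
  have hU := Set.ncard_union_eq hd (hFfin.subset hSF) hWfin
  have hsub : {q | rcv p q = some (some m)} ∪ W ⊆ {q | rcv p q ≠ none} := by
    rintro q (hq | hq)
    · have hq' : rcv p q = some (some m) := hq
      simp [hq']
    · simp [hbcast q hq p]
  have hle := Set.ncard_le_ncard hsub (hfin p)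
  omega
end

section
/- Under the two-round commit-adopt model, the agreement property holds: if some processor p outputs commit(w) and some processor p' outputs commit(w') or adopt(w'), then w' = w. -/
/-- Two strict majorities for different messages in the same round are impossible. -/
theorem maj_unique {P M : Type*} (rcv : P → P → Option (Option M))
    (hfin : ∀ p : P, {q | rcv p q ≠ none}.Finite)
    (noeq : ∀ p p' q : P, ∀ m m' : M,
      rcv p q = some (some m) → rcv p' q = some (some m') → m = m')
    (fnote : ∀ p p' q : P, ∀ m : M, rcv p q = some (some m) → rcv p' q ≠ none)
    (p p' : P) (m m' : M)
    (h : 2 * {q | rcv p q = some (some m)}.ncard > {q | rcv p q ≠ none}.ncard)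
    (h' : 2 * {q | rcv p' q = some (some m')}.ncard > {q | rcv p' q ≠ none}.ncard) :
    m = m' := by
  by_contra hne
  have sub : ∀ r x y, {q | rcv x q = some (some y)} ⊆ {q | rcv r q ≠ none} :=
    fun r x y q hq => fnote x r q y hq
  have hd : Disjoint {q | rcv p q = some (some m)} {q | rcv p' q = some (some m')} :=
    Set.disjoint_left.2 fun q h1 h2 => hne (noeq p p' q m m' h1 h2)
  have hu := Set.ncard_union_eq hd ((hfin p).subset (sub p p m)) ((hfin p).subset (sub p p' m'))
  have h1 := Set.ncard_le_ncard (Set.union_subset (sub p p m) (sub p p' m')) (hfin p)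
  have h2 := Set.ncard_le_ncard (Set.union_subset (sub p' p m) (sub p' p' m')) (hfin p')
  omega

/-- Agreement of the two-round commit-adopt algorithm.
Round-1 messages have type `V`; round-2 messages have type `V ⊕ Unit`, where
`Sum.inl w` is propose-commit(w) and `Sum.inr ()` is no-commit.
Outputs are `Bool × V`, where `(true, w)` is commit(w) and `(false, w)` is adopt(w). -/
theorem stmt_8 {P V : Type*}
    (rcv1 : P → P → Option (Option V)) (rcv2 : P → P → Option (Option (V ⊕ Unit)))
    (hfin1 : ∀ p : P, {q | rcv1 p q ≠ none}.Finite)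
    (hfin2 : ∀ p : P, {q | rcv2 p q ≠ none}.Finite)
    (noeq1 : ∀ p p' q : P, ∀ m m' : V,
      rcv1 p q = some (some m) → rcv1 p' q = some (some m') → m = m')
    (fnote1 : ∀ p p' q : P, ∀ m : V, rcv1 p q = some (some m) → rcv1 p' q ≠ none)
    (noeq2 : ∀ p p' q : P, ∀ m m' : V ⊕ Unit,
      rcv2 p q = some (some m) → rcv2 p' q = some (some m') → m = m')
    (fnote2 : ∀ p p' q : P, ∀ m : V ⊕ Unit, rcv2 p q = some (some m) → rcv2 p' q ≠ none)
    (W1 F1 W2 F2 : Set P)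
    (hW1fin : W1.Finite) (hF1fin : F1.Finite) (hW2fin : W2.Finite) (hF2fin : F2.Finite)
    (hdisj1 : Disjoint W1 F1) (hcard1 : F1.ncard < W1.ncard)
    (hdisj2 : Disjoint W2 F2) (hcard2 : F2.ncard < W2.ncard)
    (b1 : P → V) (b2 : P → V ⊕ Unit)
    (hbcast1 : ∀ q ∈ W1, ∀ p : P, rcv1 p q = some (some (b1 q)))
    (hheard1 : ∀ p q : P, rcv1 p q ≠ none → q ∈ W1 ∪ F1)
    (hbcast2 : ∀ q ∈ W2, ∀ p : P, rcv2 p q = some (some (b2 q)))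
    (hheard2 : ∀ p q : P, rcv2 p q ≠ none → q ∈ W2 ∪ F2)
    (inp : P → V)
    (hb1 : ∀ q ∈ W1, b1 q = inp q)
    (hb2 : ∀ q ∈ W2,
      (∃ w : V, 2 * {q' | rcv1 q q' = some (some w)}.ncard > {q' | rcv1 q q' ≠ none}.ncard ∧
        b2 q = Sum.inl w) ∨
      ((¬ ∃ w : V, 2 * {q' | rcv1 q q' = some (some w)}.ncard > {q' | rcv1 q q' ≠ none}.ncard) ∧
        b2 q = Sum.inr ()))
    (out : P → Bool × V)
    (hout : ∀ p : P,
      (∃ w : V, 2 * {q | rcv2 p q = some (some (Sum.inl w))}.ncard > {q | rcv2 p q ≠ none}.ncard ∧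
        out p = (true, w)) ∨
      ((¬ ∃ w : V, 2 * {q | rcv2 p q = some (some (Sum.inl w))}.ncard >
          {q | rcv2 p q ≠ none}.ncard) ∧
        (∃ w : V, 1 ≤ {q | rcv2 p q = some (some (Sum.inl w))}.ncard ∧
          (∀ w' : V, w' ≠ w → {q | rcv2 p q = some (some (Sum.inl w'))}.ncard <
            {q | rcv2 p q = some (some (Sum.inl w))}.ncard) ∧
          out p = (false, w))) ∨
      ((¬ ∃ w : V, 2 * {q | rcv2 p q = some (some (Sum.inl w))}.ncard >
          {q | rcv2 p q ≠ none}.ncard) ∧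
        (¬ ∃ w : V, 1 ≤ {q | rcv2 p q = some (some (Sum.inl w))}.ncard ∧
          ∀ w' : V, w' ≠ w → {q | rcv2 p q = some (some (Sum.inl w'))}.ncard <
            {q | rcv2 p q = some (some (Sum.inl w))}.ncard) ∧
        out p = (false, inp p)))
    (p p' : P) (w w' : V)
    (hp : out p = (true, w))
    (hp' : out p' = (true, w') ∨ out p' = (false, w')) :
    w' = w := by
  have key : 2 * {q | rcv2 p q = some (some (Sum.inl w))}.ncard > {q | rcv2 p q ≠ none}.ncard := by
    rcases hout p with ⟨v, hv, ho⟩ | ⟨_, v, _, _, ho⟩ | ⟨_, _, ho⟩ <;> rw [hp] at ho <;>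
      simp at ho
    subst ho
    exact hv
  -- split the supporters of `w` at `p`
  set A := {q | rcv2 p q = some (some (Sum.inl w))} with hA
  set H := {q | rcv2 p q ≠ none} with hH
  have hAH : A ⊆ H := fun q hq => fnote2 p p q _ hq
  have hWH : W2 ⊆ H := fun q hq => fnote2 p p q _ (hbcast2 q hq p)
  have hAfin : A.Finite := (hfin2 p).subset hAH
  have hsplit : (A ∩ W2).ncard + (A \ W2).ncard = A.ncard :=
    Set.ncard_inter_add_ncard_sdiff_eq_ncard A W2 hAfin
  have hAF : A \ W2 ⊆ F2 := fun q hq => (hheard2 p q (hAH hq.1)).resolve_left hq.2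
  have hdWA : Disjoint W2 (A \ W2) := Set.disjoint_sdiff_right
  have hWA := Set.ncard_union_eq hdWA hW2fin (hAfin.subset Set.sdiff_subset)
  have hWAle := Set.ncard_le_ncard
    (Set.union_subset hWH (Set.sdiff_subset.trans hAH) : W2 ∪ (A \ W2) ⊆ H) (hfin2 p)
  have hAFle := Set.ncard_le_ncard hAF hF2fin
  have hpos : 0 < (A ∩ W2).ncard := by omega
  obtain ⟨q0, hq0A, hq0W⟩ := (Set.ncard_pos (hAfin.subset Set.inter_subset_left)).1 hpos
  have hbw : b2 q0 = Sum.inl w := noeq2 p p q0 _ _ (hbcast2 q0 hq0W p) hq0A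
  have hmaj : ∀ q ∈ W2, ∀ v, b2 q = Sum.inl v →
      2 * {q' | rcv1 q q' = some (some v)}.ncard > {q' | rcv1 q q' ≠ none}.ncard := by
    intro q hq v hv
    rcases hb2 q hq with ⟨u, hu, hbu⟩ | ⟨_, hbu⟩ <;> rw [hv] at hbu <;> simp at hbu
    subst hbu
    exact hu
  have huniq : ∀ q ∈ W2, ∀ v, b2 q = Sum.inl v → v = w := fun q hq v hv =>
    maj_unique rcv1 hfin1 noeq1 fnote1 q q0 v w (hmaj q hq v hv) (hmaj q0 hq0W w hbw)
  have hle : (A ∩ W2).ncard ≤ {q | rcv2 p' q = some (some (Sum.inl w))}.ncard := by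
    apply Set.ncard_le_ncard
    · rintro q ⟨hqA, hqW⟩
      have hb : b2 q = Sum.inl w := noeq2 p p q _ _ (hbcast2 q hqW p) hqA
      have := hbcast2 q hqW p'
      rw [hb] at this
      exact this
    · exact (hfin2 p').subset fun q hq => fnote2 p' p' q _ hq
  have hlt : ∀ v, v ≠ w → {q | rcv2 p' q = some (some (Sum.inl v))}.ncard <
      {q | rcv2 p' q = some (some (Sum.inl w))}.ncard := by
    intro v hv
    set C := {q | rcv2 p' q = some (some (Sum.inl v))} with hC
    have hCH : C ⊆ H := fun q hq => fnote2 p' p q _ hq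
    have hCW : ∀ q ∈ C, q ∉ W2 := fun q hq hqW =>
      hv (huniq q hqW v (noeq2 p' p' q _ _ (hbcast2 q hqW p') hq))
    have hCF : C ⊆ F2 := fun q hq => (hheard2 p q (hCH hq)).resolve_left (hCW q hq)
    have hCfin : C.Finite := hF2fin.subset hCF
    have hCA : Disjoint (A \ W2) C := Set.disjoint_left.2 fun q h1 h2 =>
      hv (Sum.inl.inj (noeq2 p' p q _ _ h2 h1.1))
    have hCWA : Disjoint (W2 ∪ (A \ W2)) C :=
      Set.disjoint_union_left.2 ⟨Set.disjoint_left.2 fun q h1 h2 => hCW q h2 h1, hCA⟩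
    have e1 := Set.ncard_union_eq hCA (hAfin.subset Set.sdiff_subset) hCfin
    have e2 := Set.ncard_le_ncard (Set.union_subset hAF hCF) hF2fin
    have e3 := Set.ncard_union_eq hCWA (hW2fin.union (hAfin.subset Set.sdiff_subset)) hCfin
    have e4 := Set.ncard_le_ncard
      (Set.union_subset (Set.union_subset hWH (Set.sdiff_subset.trans hAH)) hCH :
        (W2 ∪ (A \ W2)) ∪ C ⊆ H) (hfin2 p)
    omega
  by_contra hne
  rcases hout p' with ⟨v, hv, ho⟩ | ⟨_, v, _, hmax, ho⟩ | ⟨_, hno, _⟩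
  · have hvw : v = w' := by rcases hp' with h | h <;> rw [h] at ho <;> simp at ho; exact ho.symm
    subst hvw
    exact hne (Sum.inl.inj (maj_unique rcv2 hfin2 noeq2 fnote2 p' p _ _ hv key))
  · have hvw : v = w' := by rcases hp' with h | h <;> rw [h] at ho <;> simp at ho; exact ho.symm
    subst hvw
    exact absurd (hmax w (Ne.symm hne)) (not_lt.2 (hlt v hne).le)
  · exact hno ⟨w, hpos.trans_le hle, hlt⟩
end

section
/- Under the two-round commit-adopt model, the validity property holds: if there is a value w such that in p = w for every processor p, then every processor outputs commit(w); in particular, every processor receives propose-commit(w) from a strict majority in round 2. -/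
theorem aux_maj {P M : Type*} (r : P → Option (Option M)) (W F : Set P) (m : M)
    (hfin : {q | r q ≠ none}.Finite) (hF : F.Finite) (hc : F.ncard < W.ncard)
    (hW : ∀ q ∈ W, r q = some (some m)) (hh : ∀ q, r q ≠ none → q ∈ W ∪ F) :
    2 * {q | r q = some (some m)}.ncard > {q | r q ≠ none}.ncard := by
  have hA : {q | r q = some (some m)}.Finite :=
    hfin.subset (fun q hq => by simp only [Set.mem_setOf_eq] at hq ⊢; simp [hq])
  have h1 : W.ncard ≤ {q | r q = some (some m)}.ncard :=
    Set.ncard_le_ncard (fun q hq => hW q hq) hA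
  have h2 : {q | r q ≠ none}.ncard ≤ ({q | r q = some (some m)} ∪ F).ncard := by
    refine Set.ncard_le_ncard (fun q hq => ?_) (hA.union hF)
    rcases hh q hq with h | h
    · exact Or.inl (hW q h)
    · exact Or.inr h
  have h3 := Set.ncard_union_le {q | r q = some (some m)} F
  omega

theorem aux_uniq {P M : Type*} (r : P → Option (Option M)) (m m' : M)
    (hfin : {q | r q ≠ none}.Finite)
    (h : 2 * {q | r q = some (some m)}.ncard > {q | r q ≠ none}.ncard)
    (h' : 2 * {q | r q = some (some m')}.ncard > {q | r q ≠ none}.ncard) : m = m' := by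
  by_contra hne
  have hs : ∀ m : M, {q | r q = some (some m)} ⊆ {q | r q ≠ none} := fun m q hq => by
    simp only [Set.mem_setOf_eq] at hq ⊢; simp [hq]
  have hd : Disjoint {q | r q = some (some m)} {q | r q = some (some m')} := by
    rw [Set.disjoint_left]
    intro q hq hq'
    simp only [Set.mem_setOf_eq] at hq hq'
    rw [hq] at hq'
    exact hne (by simpa using hq')
  have h1 := Set.ncard_union_eq hd (hfin.subset (hs m)) (hfin.subset (hs m'))
  have h2 := Set.ncard_le_ncard (Set.union_subset (hs m) (hs m')) hfin
  omega

/-- Validity of the two-round commit-adopt algorithm.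
Round-1 messages have type `V`; round-2 messages have type `V ⊕ Unit`, where
`Sum.inl w` is propose-commit(w) and `Sum.inr ()` is no-commit.
Outputs are `Bool × V`, where `(true, w)` is commit(w) and `(false, w)` is adopt(w). -/
theorem stmt_9 {P V : Type*}
    (rcv1 : P → P → Option (Option V)) (rcv2 : P → P → Option (Option (V ⊕ Unit)))
    (hfin1 : ∀ p : P, {q | rcv1 p q ≠ none}.Finite)
    (hfin2 : ∀ p : P, {q | rcv2 p q ≠ none}.Finite)
    (noeq1 : ∀ p p' q : P, ∀ m m' : V,
      rcv1 p q = some (some m) → rcv1 p' q = some (some m') → m = m')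
    (fnote1 : ∀ p p' q : P, ∀ m : V, rcv1 p q = some (some m) → rcv1 p' q ≠ none)
    (noeq2 : ∀ p p' q : P, ∀ m m' : V ⊕ Unit,
      rcv2 p q = some (some m) → rcv2 p' q = some (some m') → m = m')
    (fnote2 : ∀ p p' q : P, ∀ m : V ⊕ Unit, rcv2 p q = some (some m) → rcv2 p' q ≠ none)
    (W1 F1 W2 F2 : Set P)
    (hW1fin : W1.Finite) (hF1fin : F1.Finite) (hW2fin : W2.Finite) (hF2fin : F2.Finite)
    (hdisj1 : Disjoint W1 F1) (hcard1 : F1.ncard < W1.ncard)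
    (hdisj2 : Disjoint W2 F2) (hcard2 : F2.ncard < W2.ncard)
    (b1 : P → V) (b2 : P → V ⊕ Unit)
    (hbcast1 : ∀ q ∈ W1, ∀ p : P, rcv1 p q = some (some (b1 q)))
    (hheard1 : ∀ p q : P, rcv1 p q ≠ none → q ∈ W1 ∪ F1)
    (hbcast2 : ∀ q ∈ W2, ∀ p : P, rcv2 p q = some (some (b2 q)))
    (hheard2 : ∀ p q : P, rcv2 p q ≠ none → q ∈ W2 ∪ F2)
    (inp : P → V)
    (hb1 : ∀ q ∈ W1, b1 q = inp q)
    (hb2 : ∀ q ∈ W2,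
      (∃ w : V, 2 * {q' | rcv1 q q' = some (some w)}.ncard > {q' | rcv1 q q' ≠ none}.ncard ∧
        b2 q = Sum.inl w) ∨
      ((¬ ∃ w : V, 2 * {q' | rcv1 q q' = some (some w)}.ncard > {q' | rcv1 q q' ≠ none}.ncard) ∧
        b2 q = Sum.inr ()))
    (out : P → Bool × V)
    (hout : ∀ p : P,
      (∃ w : V, 2 * {q | rcv2 p q = some (some (Sum.inl w))}.ncard > {q | rcv2 p q ≠ none}.ncard ∧
        out p = (true, w)) ∨
      ((¬ ∃ w : V, 2 * {q | rcv2 p q = some (some (Sum.inl w))}.ncard >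
          {q | rcv2 p q ≠ none}.ncard) ∧
        (∃ w : V, 1 ≤ {q | rcv2 p q = some (some (Sum.inl w))}.ncard ∧
          (∀ w' : V, w' ≠ w → {q | rcv2 p q = some (some (Sum.inl w'))}.ncard <
            {q | rcv2 p q = some (some (Sum.inl w))}.ncard) ∧
          out p = (false, w))) ∨
      ((¬ ∃ w : V, 2 * {q | rcv2 p q = some (some (Sum.inl w))}.ncard >
          {q | rcv2 p q ≠ none}.ncard) ∧
        (¬ ∃ w : V, 1 ≤ {q | rcv2 p q = some (some (Sum.inl w))}.ncard ∧
          ∀ w' : V, w' ≠ w → {q | rcv2 p q = some (some (Sum.inl w'))}.ncard <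
            {q | rcv2 p q = some (some (Sum.inl w))}.ncard) ∧
        out p = (false, inp p)))
    (w : V) (hall : ∀ p : P, inp p = w) :
    ∀ p : P,
      2 * {q | rcv2 p q = some (some (Sum.inl w))}.ncard > {q | rcv2 p q ≠ none}.ncard ∧
      out p = (true, w) := by
  have hW1 : ∀ p : P,
      2 * {q | rcv1 p q = some (some w)}.ncard > {q | rcv1 p q ≠ none}.ncard := fun p =>
    aux_maj (rcv1 p) W1 F1 w (hfin1 p) hF1fin hcard1
      (fun q hq => by rw [hbcast1 q hq p, hb1 q hq, hall q]) (hheard1 p)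
  have hB : ∀ q ∈ W2, b2 q = Sum.inl w := by
    intro q hq
    rcases hb2 q hq with ⟨v, hv, hbv⟩ | ⟨hn, _⟩
    · rw [hbv, aux_uniq (rcv1 q) v w (hfin1 q) hv (hW1 q)]
    · exact absurd ⟨w, hW1 q⟩ hn
  intro p
  have hm := aux_maj (rcv2 p) W2 F2 (Sum.inl w) (hfin2 p) hF2fin hcard2
    (fun q hq => by rw [hbcast2 q hq p, hB q hq]) (hheard2 p)
  refine ⟨hm, ?_⟩
  rcases hout p with ⟨v, hv, ho⟩ | ⟨hn, _⟩ | ⟨hn, _⟩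
  · rw [ho, Sum.inl.inj (aux_uniq (rcv2 p) _ _ (hfin2 p) hv hm)]
  · exact absurd ⟨w, hm⟩ hn
  · exact absurd ⟨w, hm⟩ hn
end

section
/- In the generic consensus algorithm obtained by alternating conciliator and commit-adopt phases, the agreement property of consensus holds: if processor i decides value w at phase n and processor j decides value w' at phase n', then w = w'. -/
/-- Agreement of the generic consensus algorithm obtained by alternating
conciliator and commit-adopt phases. `(true, w)` means commit(w), `(false, w)` adopt(w). -/
theorem stmt_10 {V I : Type*}
    (C : ℕ → (I → V) → (I → V))
    (CA : ℕ → (I → V) → I → Bool × V)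
    (hCval : ∀ (n : ℕ) (x : I → V) (w : V), (∀ i, x i = w) → ∀ i, C n x i = w)
    (hCAval : ∀ (n : ℕ) (x : I → V) (w : V), (∀ i, x i = w) → ∀ i, CA n x i = (true, w))
    (hCAagr : ∀ (n : ℕ) (x : I → V) (i j : I), (CA n x i).1 = true →
      (CA n x j).2 = (CA n x i).2)
    (inp : I → V) (x : ℕ → I → V)
    (hx0 : x 0 = inp)
    (hxs : ∀ n, x (n + 1) = fun i => (CA n (C n (x n)) i).2)
    (i j : I) (n n' : ℕ) (w w' : V)
    (hi : CA n (C n (x n)) i = (true, w))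
    (hj : CA n' (C n' (x n')) j = (true, w')) :
    w = w' := by
  have key : ∀ (i : I) (n : ℕ) (w : V), CA n (C n (x n)) i = (true, w) →
      ∀ m, n ≤ m → ∀ k, (CA m (C m (x m)) k).2 = w := by
    intro i n w hi m hm
    induction m, hm using Nat.le_induction with
    | base =>
      intro k
      have h := hCAagr n (C n (x n)) i k (by rw [hi])
      rw [h, hi]
    | succ m _ ih =>
      intro k
      have hx : ∀ l, x (m + 1) l = w := by
        intro l
        rw [hxs m]
        exact ih l
      rw [hCAval (m + 1) _ w (hCval (m + 1) _ w hx) k]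
  rcases le_total n n' with h | h
  · have h1 := key i n w hi n' h j
    rw [hj] at h1
    exact h1.symm
  · have h1 := key j n' w' hj n h i
    rw [hi] at h1
    exact h1
end
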